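/- arXiv:2312.06311 — 4 statements merged into one kernel-verified Lean document; each statement's English description precedes it below -/
import Mathlib

section
/- The function F : ℝ → ℝ defined by F(σ′) = ∫_ℝ (σ² + σ′)⁻¹ · θ((σ² + σ′)/(σ² + 1)) dσ is infinitely differentiable on all of ℝ. -/
open MeasureTheory

lemma integrable_mul_comp_affine {α : Type*} [MeasurableSpace α] {μ : Measure α}
    {h : ℝ → ℝ} (hh : Continuous h) {a b w : α → ℝ} (ha : Measurable a) (hb : Measurable b)
    {A B : ℝ} (haA : ∀ x, |a x| ≤ A) (hbB : ∀ x, |b x| ≤ B) (hw : Integrable w μ) (s : ℝ) :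
    Integrable (fun x => w x * h (b x + s * a x)) μ := by
  obtain ⟨C, hC⟩ := (isCompact_Icc (a := -(B + |s| * A)) (b := B + |s| * A)).exists_bound_of_continuousOn
    hh.continuousOn
  refine hw.mul_bdd (c := C)
    (hh.measurable.comp (hb.add (ha.const_mul s))).aestronglyMeasurable (.of_forall fun x => ?_)
  refine hC _ (abs_le.mp ((abs_add_le _ _).trans ?_))
  rw [abs_mul]
  gcongr
  exacts [hbB x, haA x]

lemma hasDerivAt_integral_mul_comp_affine {α : Type*} [MeasurableSpace α] {μ : Measure α}
    {h : ℝ → ℝ} (hh : ContDiff ℝ 1 h) {a b w : α → ℝ} (ha : Measurable a) (hb : Measurable b)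
    {A B : ℝ} (haA : ∀ x, |a x| ≤ A) (hbB : ∀ x, |b x| ≤ B) (hw : Integrable w μ) (s : ℝ) :
    HasDerivAt (fun s => ∫ x, w x * h (b x + s * a x) ∂μ)
      (∫ x, w x * a x * deriv h (b x + s * a x) ∂μ) s := by
  have hd : Continuous (deriv h) := hh.continuous_deriv le_rfl
  have hwa : Integrable (fun x => w x * a x) μ :=
    hw.mul_bdd (c := A) ha.aestronglyMeasurable (.of_forall haA)
  obtain ⟨C, hC⟩ := (isCompact_Icc (a := -(B + (|s| + 1) * A))
    (b := B + (|s| + 1) * A)).exists_bound_of_continuousOn hd.continuousOn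
  refine (hasDerivAt_integral_of_dominated_loc_of_deriv_le
    (F' := fun s x => w x * a x * deriv h (b x + s * a x))
    (bound := fun x => ‖w x * a x‖ * C)
    (Metric.ball_mem_nhds s one_pos) (.of_forall fun r =>
      (integrable_mul_comp_affine hh.continuous ha hb haA hbB hw r).aestronglyMeasurable)
    (integrable_mul_comp_affine hh.continuous ha hb haA hbB hw s)
    (integrable_mul_comp_affine hd ha hb haA hbB hwa s).aestronglyMeasurable
    (.of_forall fun x r hr => ?_) (hwa.norm.mul_const C) (.of_forall fun x r _ => ?_)).2
  · rw [norm_mul]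
    refine mul_le_mul_of_nonneg_left (hC _ (abs_le.mp ((abs_add_le _ _).trans ?_))) (norm_nonneg _)
    have hrs : |r| ≤ |s| + 1 := by
      rw [Metric.mem_ball, Real.dist_eq] at hr
      linarith [abs_sub_abs_le_abs_sub r s]
    rw [abs_mul]
    gcongr
    exacts [hbB x, haA x]
  · have haff : HasDerivAt (fun r => b x + r * a x) (a x) r := by
      simpa using ((hasDerivAt_id r).mul_const (a x)).const_add (b x)
    have := (((hh.differentiable one_ne_zero) (b x + r * a x)).hasDerivAt.comp r haff).const_mul (w x)
    exact this.congr_deriv (by ring)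

lemma contDiff_integral_mul_comp_affine {α : Type*} [MeasurableSpace α] {μ : Measure α}
    {h : ℝ → ℝ} (hh : ContDiff ℝ (⊤ : ℕ∞) h) {a b w : α → ℝ} (ha : Measurable a)
    (hb : Measurable b) {A B : ℝ} (haA : ∀ x, |a x| ≤ A) (hbB : ∀ x, |b x| ≤ B)
    (hw : Integrable w μ) :
    ContDiff ℝ (⊤ : ℕ∞) (fun s => ∫ x, w x * h (b x + s * a x) ∂μ) := by
  refine contDiff_infty.mpr fun n => ?_
  induction n generalizing h w with
  | zero =>
    exact contDiff_zero.mpr <| continuous_iff_continuousAt.mpr fun s =>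
      (hasDerivAt_integral_mul_comp_affine (hh.of_le (by exact_mod_cast le_top)) ha hb haA hbB
        hw s).continuousAt
  | succ n ih =>
    have hderiv := hasDerivAt_integral_mul_comp_affine
      (hh.of_le (by exact_mod_cast le_top)) ha hb haA hbB hw
    push_cast
    refine contDiff_succ_iff_deriv.mpr ⟨fun s => (hderiv s).differentiableAt, by simp, ?_⟩
    rw [funext fun s => (hderiv s).deriv]
    exact ih (contDiff_infty_iff_deriv.mp hh).2
      (hw.mul_bdd (c := A) ha.aestronglyMeasurable (.of_forall haA))

lemma contDiff_inv_mul_of_eq_zero {n : WithTop ℕ∞} {θ : ℝ → ℝ} (hθ : ContDiff ℝ n θ)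
    {c : ℝ} (hc : 0 < c) (hθ0 : ∀ t ≤ c, θ t = 0) : ContDiff ℝ n (fun t => t⁻¹ * θ t) := by
  refine contDiff_iff_contDiffAt.mpr fun t => ?_
  rcases lt_or_ge t c with ht | ht
  · refine (contDiffAt_const (c := (0 : ℝ))).congr_of_eventuallyEq ?_
    filter_upwards [Iio_mem_nhds ht] with u hu
    rw [hθ0 u (le_of_lt hu), mul_zero]
  · exact (contDiffAt_inv ℝ (hc.trans_le ht).ne').mul hθ.contDiffAt

/-- The function `F(σ') = ∫_ℝ (σ² + σ')⁻¹ θ((σ² + σ')/(σ² + 1)) dσ` arising in the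
construction of the tangential parametrix symbol is infinitely differentiable on ℝ. -/
theorem F_contDiff
    (θ F : ℝ → ℝ)
    (hθ : ContDiff ℝ (⊤ : ℕ∞) θ)
    (hθ01 : ∀ σ, θ σ ∈ Set.Icc (0 : ℝ) 1)
    (hθ0 : ∀ σ ≤ (1 : ℝ) / 10, θ σ = 0)
    (hθ1 : ∀ σ ≥ (1 : ℝ) / 5, θ σ = 1)
    (hF : ∀ σ' : ℝ, F σ' = ∫ σ : ℝ, (σ ^ 2 + σ')⁻¹ * θ ((σ ^ 2 + σ') / (σ ^ 2 + 1))) :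
    ContDiff ℝ (⊤ : ℕ∞) F := by
  have hpos (x : ℝ) : 0 < x ^ 2 + 1 := by positivity
  have hw : Integrable fun x : ℝ => (x ^ 2 + 1)⁻¹ := by
    simpa only [add_comm] using integrable_inv_one_add_sq
  have key := contDiff_integral_mul_comp_affine (μ := volume)
    (contDiff_inv_mul_of_eq_zero hθ (by norm_num) hθ0)
    (a := fun x : ℝ => (x ^ 2 + 1)⁻¹) (b := fun x => x ^ 2 * (x ^ 2 + 1)⁻¹) (A := 1) (B := 1)
    (by fun_prop) (by fun_prop)
    (fun x => by
      rw [abs_of_nonneg (by positivity)]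
      exact inv_le_one_of_one_le₀ (by nlinarith))
    (fun x => by
      rw [abs_of_nonneg (by positivity), ← div_eq_mul_inv, div_le_one (hpos x)]
      linarith) hw
  convert key using 1
  funext s
  rw [hF]
  congr 1
  funext x
  rw [← add_mul, ← div_eq_mul_inv, inv_div, ← mul_assoc, ← mul_div_assoc,
    inv_mul_cancel₀ (hpos x).ne', one_div]
end

section
/- For every σ′ < 1/5 one has F(σ′) = ∫_{σ′}^{1} θ(σ) / (σ · √(1 − σ) · √(σ − σ′)) dσ. -/
open MeasureTheory

lemma one_sub_sq_add_div (a s : ℝ) :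
    1 - (s ^ 2 + a) / (s ^ 2 + 1) = (1 - a) / (s ^ 2 + 1) := by
  have : s ^ 2 + 1 ≠ 0 := by positivity
  field_simp
  ring

lemma sq_add_div_sub (a s : ℝ) :
    (s ^ 2 + a) / (s ^ 2 + 1) - a = s ^ 2 * (1 - a) / (s ^ 2 + 1) := by
  have : s ^ 2 + 1 ≠ 0 := by positivity
  field_simp
  ring

lemma hasDerivAt_sq_add_div (a s : ℝ) :
    HasDerivAt (fun s : ℝ => (s ^ 2 + a) / (s ^ 2 + 1))
      (2 * s * (1 - a) / (s ^ 2 + 1) ^ 2) s := by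
  have h : s ^ 2 + 1 ≠ 0 := by positivity
  refine (((hasDerivAt_pow 2 s).add_const a).div
    ((hasDerivAt_pow 2 s).add_const 1) h).congr_deriv ?_
  push_cast
  ring

lemma injOn_sq_add_div {a : ℝ} (ha : a < 1) :
    Set.InjOn (fun s : ℝ => (s ^ 2 + a) / (s ^ 2 + 1)) (Set.Ioi 0) := by
  intro x hx y hy hxy
  have hx' : x ^ 2 + 1 ≠ 0 := by positivity
  have hy' : y ^ 2 + 1 ≠ 0 := by positivity
  have h : (1 - a) * (x ^ 2 - y ^ 2) = 0 := by
    rw [div_eq_div_iff hx' hy'] at hxy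
    linarith
  have hsq : x ^ 2 = y ^ 2 := by
    rcases mul_eq_zero.1 h with h | h <;> linarith
  exact (sq_eq_sq₀ (le_of_lt hx) (le_of_lt hy)).1 hsq

lemma image_sq_add_div {a : ℝ} (ha : a < 1) :
    (fun s : ℝ => (s ^ 2 + a) / (s ^ 2 + 1)) '' Set.Ioi 0 = Set.Ioo a 1 := by
  have ha' : 0 < 1 - a := sub_pos.2 ha
  ext t
  constructor
  · rintro ⟨s, hs, rfl⟩
    have hs : 0 < s := hs
    exact ⟨sub_pos.1 (by rw [sq_add_div_sub]; positivity),
      sub_pos.1 (by rw [one_sub_sq_add_div]; positivity)⟩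
  · rintro ⟨h1, h2⟩
    have h1' : 0 < t - a := sub_pos.2 h1
    have h2' : 0 < 1 - t := sub_pos.2 h2
    refine ⟨√((t - a) / (1 - t)), Real.sqrt_pos.2 (by positivity), ?_⟩
    simp only [Real.sq_sqrt (show 0 ≤ (t - a) / (1 - t) by positivity)]
    rw [div_add' _ _ _ h2'.ne', div_add' _ _ _ h2'.ne', div_div_div_cancel_right₀ h2'.ne',
      div_eq_iff (by linarith)]
    ring

lemma sqrt_mul_sqrt_sq_add_div {a s : ℝ} (ha : a < 1) (hs : 0 < s) :
    √(1 - (s ^ 2 + a) / (s ^ 2 + 1)) * √((s ^ 2 + a) / (s ^ 2 + 1) - a) =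
      s * (1 - a) / (s ^ 2 + 1) := by
  have ha' : 0 < 1 - a := sub_pos.2 ha
  rw [one_sub_sq_add_div, sq_add_div_sub, ← Real.sqrt_mul (by positivity),
    ← Real.sqrt_sq (show 0 ≤ s * (1 - a) / (s ^ 2 + 1) by positivity)]
  congr 1
  ring

/-- The substitution `t = (s ^ 2 + a) / (s ^ 2 + 1)`, valid for arbitrary `g`. -/
lemma integral_inv_sq_add_mul_comp {a : ℝ} (ha : a < 1) (g : ℝ → ℝ) :
    ∫ s : ℝ, (s ^ 2 + a)⁻¹ * g ((s ^ 2 + a) / (s ^ 2 + 1)) =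
      ∫ t in a..(1 : ℝ), g t / (t * √(1 - t) * √(t - a)) := by
  have heven := integral_comp_abs
    (f := fun s : ℝ => (s ^ 2 + a)⁻¹ * g ((s ^ 2 + a) / (s ^ 2 + 1)))
  simp only [sq_abs] at heven
  rw [heven, intervalIntegral.integral_of_le ha.le, integral_Ioc_eq_integral_Ioo,
    ← image_sq_add_div ha, integral_image_eq_integral_abs_deriv_smul measurableSet_Ioi
      (fun s _ => (hasDerivAt_sq_add_div a s).hasDerivWithinAt) (injOn_sq_add_div ha),
    ← integral_const_mul]
  refine setIntegral_congr_fun measurableSet_Ioi fun s hs => ?_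
  have hs : 0 < s := hs
  have ha' : 0 < 1 - a := sub_pos.2 ha
  have h1 : s ^ 2 + 1 ≠ 0 := by positivity
  simp only [smul_eq_mul]
  rw [abs_of_nonneg (by positivity), mul_assoc (_ / _) √_ √_, sqrt_mul_sqrt_sq_add_div ha hs]
  generalize g ((s ^ 2 + a) / (s ^ 2 + 1)) = c
  rw [div_eq_mul_inv c, mul_inv, inv_div, div_eq_mul_inv (s ^ 2 + 1)]
  generalize (s ^ 2 + a)⁻¹ = d
  field_simp

/-- Change of variables for `F` when `σ' < 1/5`:
`F(σ') = ∫_{σ'}^{1} θ(σ) / (σ √(1-σ) √(σ-σ')) dσ`. -/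
theorem F_eq_intervalIntegral_of_lt
    (θ F : ℝ → ℝ)
    (hθ : ContDiff ℝ (⊤ : ℕ∞) θ)
    (hθ01 : ∀ σ, θ σ ∈ Set.Icc (0 : ℝ) 1)
    (hθ0 : ∀ σ ≤ (1 : ℝ) / 10, θ σ = 0)
    (hθ1 : ∀ σ ≥ (1 : ℝ) / 5, θ σ = 1)
    (hF : ∀ σ' : ℝ, F σ' = ∫ σ : ℝ, (σ ^ 2 + σ')⁻¹ * θ ((σ ^ 2 + σ') / (σ ^ 2 + 1))) :
    ∀ σ' : ℝ, σ' < 1 / 5 →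
      F σ' = ∫ σ in σ'..(1 : ℝ), θ σ / (σ * Real.sqrt (1 - σ) * Real.sqrt (σ - σ')) := by
  intro a ha
  rw [hF, integral_inv_sq_add_mul_comp (by linarith)]
end

section
/- For every σ′ ≤ 1/10 one has F(σ′) = ∫_{1/10}^{1} θ(σ) / (σ · √(1 − σ) · √(σ − σ′)) dσ. -/
open MeasureTheory

/-- The derivative of `σ ↦ (σ² + a) / (σ² + 1)`. -/
lemma hasDerivAt_sq_add_div_sq_add_one (a σ : ℝ) :
    HasDerivAt (fun σ : ℝ => (σ ^ 2 + a) / (σ ^ 2 + 1))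
      (2 * σ * (1 - a) / (σ ^ 2 + 1) ^ 2) σ := by
  have h0 : σ ^ 2 + 1 ≠ 0 := by positivity
  have h : HasDerivAt (fun σ : ℝ => σ ^ 2) (2 * σ) σ := by
    simpa using hasDerivAt_pow 2 σ
  exact ((h.add_const a).fun_div (h.add_const 1) h0).congr_deriv (by ring)

lemma one_sub_sq_add_div_sq_add_one (a σ : ℝ) :
    1 - (σ ^ 2 + a) / (σ ^ 2 + 1) = (1 - a) / (σ ^ 2 + 1) := by
  have h0 : σ ^ 2 + 1 ≠ 0 := by positivity
  field_simp
  ring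

lemma sq_add_div_sq_add_one_sub (a σ : ℝ) :
    (σ ^ 2 + a) / (σ ^ 2 + 1) - a = σ ^ 2 * ((1 - a) / (σ ^ 2 + 1)) := by
  have h0 : σ ^ 2 + 1 ≠ 0 := by positivity
  field_simp
  ring

/-- For `a < 1` the map `σ ↦ (σ² + a) / (σ² + 1)` is injective on `(0, ∞)`. -/
lemma injOn_sq_add_div_sq_add_one {a : ℝ} (ha : a < 1) :
    Set.InjOn (fun σ : ℝ => (σ ^ 2 + a) / (σ ^ 2 + 1)) (Set.Ioi 0) := by
  intro x hx y hy h
  have h1 := one_sub_sq_add_div_sq_add_one a x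
  have h2 := one_sub_sq_add_div_sq_add_one a y
  simp only at h
  rw [h, h2, div_eq_div_iff (by positivity) (by positivity),
    mul_right_inj' (by linarith)] at h1
  exact (pow_left_inj₀ (le_of_lt hx) (le_of_lt hy) two_ne_zero).1 (by linarith)

/-- For `a < 1` the map `σ ↦ (σ² + a) / (σ² + 1)` sends `(0, ∞)` onto `(a, 1)`. -/
lemma image_sq_add_div_sq_add_one {a : ℝ} (ha : a < 1) :
    (fun σ : ℝ => (σ ^ 2 + a) / (σ ^ 2 + 1)) '' Set.Ioi 0 = Set.Ioo a 1 := by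
  ext s
  constructor
  · rintro ⟨σ, hσ, rfl⟩
    have hσ : 0 < σ := hσ
    have hpos : 0 < (1 - a) / (σ ^ 2 + 1) := div_pos (by linarith) (by positivity)
    have h1 := one_sub_sq_add_div_sq_add_one a σ
    have h2 := sq_add_div_sq_add_one_sub a σ
    have h3 : 0 < σ ^ 2 * ((1 - a) / (σ ^ 2 + 1)) := by positivity
    exact ⟨by dsimp only; linarith, by dsimp only; linarith⟩
  · rintro ⟨h1, h2⟩
    have hs : 0 < 1 - s := by linarith
    have hq : 0 < (s - a) / (1 - s) := div_pos (by linarith) hs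
    refine ⟨Real.sqrt ((s - a) / (1 - s)), Real.sqrt_pos.2 hq, ?_⟩
    dsimp only
    rw [Real.sq_sqrt hq.le, div_eq_iff (by positivity)]
    field_simp
    ring

/-- Change of variables `s = (σ² + a) / (σ² + 1)` on the half line. -/
lemma integral_Ioo_div_sqrt_eq_integral_Ioi (θ : ℝ → ℝ) {a : ℝ} (ha : a < 1) :
    ∫ s in Set.Ioo a 1, θ s / (s * Real.sqrt (1 - s) * Real.sqrt (s - a)) =
      2 * ∫ σ in Set.Ioi (0 : ℝ), (σ ^ 2 + a)⁻¹ * θ ((σ ^ 2 + a) / (σ ^ 2 + 1)) := by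
  rw [← image_sq_add_div_sq_add_one ha,
    integral_image_eq_integral_abs_deriv_smul measurableSet_Ioi
      (fun σ _ => (hasDerivAt_sq_add_div_sq_add_one a σ).hasDerivWithinAt)
      (injOn_sq_add_div_sq_add_one ha), ← integral_const_mul]
  refine setIntegral_congr_fun measurableSet_Ioi fun σ hσ => ?_
  have hσ : 0 < σ := hσ
  have ha' : 0 < 1 - a := by linarith
  have h0 : 0 < σ ^ 2 + 1 := by positivity
  have hr : 0 ≤ (1 - a) / (σ ^ 2 + 1) := by positivity
  simp only [smul_eq_mul]
  rw [one_sub_sq_add_div_sq_add_one, sq_add_div_sq_add_one_sub, Real.sqrt_mul (sq_nonneg σ),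
    Real.sqrt_sq hσ.le, abs_of_pos (by positivity)]
  generalize θ ((σ ^ 2 + a) / (σ ^ 2 + 1)) = t
  have key : (σ ^ 2 + a) / (σ ^ 2 + 1) * Real.sqrt ((1 - a) / (σ ^ 2 + 1)) *
      (σ * Real.sqrt ((1 - a) / (σ ^ 2 + 1))) =
      (σ ^ 2 + a) / (σ ^ 2 + 1) * σ * ((1 - a) / (σ ^ 2 + 1)) := by
    linear_combination (σ ^ 2 + a) / (σ ^ 2 + 1) * σ * Real.mul_self_sqrt hr
  rw [key]
  by_cases hz : σ ^ 2 + a = 0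
  · simp [hz]
  · field_simp

/-- For `σ' ≤ 1/10` the integral defining `F` reduces to an integral over `[1/10, 1]`:
`F(σ') = ∫_{1/10}^{1} θ(σ) / (σ √(1-σ) √(σ-σ')) dσ`. -/
theorem F_eq_intervalIntegral_of_le
    (θ F : ℝ → ℝ)
    (hθ : ContDiff ℝ (⊤ : ℕ∞) θ)
    (hθ01 : ∀ σ, θ σ ∈ Set.Icc (0 : ℝ) 1)
    (hθ0 : ∀ σ ≤ (1 : ℝ) / 10, θ σ = 0)
    (hθ1 : ∀ σ ≥ (1 : ℝ) / 5, θ σ = 1)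
    (hF : ∀ σ' : ℝ, F σ' = ∫ σ : ℝ, (σ ^ 2 + σ')⁻¹ * θ ((σ ^ 2 + σ') / (σ ^ 2 + 1))) :
    ∀ σ' : ℝ, σ' ≤ 1 / 10 →
      F σ' = ∫ σ in (1 / 10 : ℝ)..1, θ σ / (σ * Real.sqrt (1 - σ) * Real.sqrt (σ - σ')) := by
  intro a ha
  have heven : ∫ σ : ℝ, (σ ^ 2 + a)⁻¹ * θ ((σ ^ 2 + a) / (σ ^ 2 + 1)) =
      2 * ∫ σ in Set.Ioi (0 : ℝ), (σ ^ 2 + a)⁻¹ * θ ((σ ^ 2 + a) / (σ ^ 2 + 1)) := by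
    have h := integral_comp_abs (f := fun σ : ℝ => (σ ^ 2 + a)⁻¹ * θ ((σ ^ 2 + a) / (σ ^ 2 + 1)))
    simp_rw [sq_abs] at h
    exact h
  rw [hF, heven, ← integral_Ioo_div_sqrt_eq_integral_Ioi θ (by linarith),
    intervalIntegral.integral_of_le (by norm_num), integral_Ioc_eq_integral_Ioo]
  refine setIntegral_eq_of_subset_of_forall_sdiff_eq_zero measurableSet_Ioo
    (Set.Ioo_subset_Ioo_left ha) fun s hs => ?_
  have hs' : s ≤ 1 / 10 := by
    by_contra! h
    exact hs.2 ⟨h, hs.1.2⟩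
  rw [hθ0 s hs', zero_div]
end

section
/- The function F is infinitely differentiable on the closed half-line (−∞, 1/10] (i.e., F is ContDiffOn of order ∞ on the set {σ′ : σ′ ≤ 1/10}). -/
open MeasureTheory

/-- A weighted integral of a smooth function along bounded affine perturbations of the parameter is
smooth in the parameter. -/
theorem contDiff_integral_mul_comp_affine_s6 {α : Type*} [MeasurableSpace α] {μ : Measure α}
    {u : α → ℝ} (hu : Measurable u) (hu1 : ∀ a, |u a| ≤ 1) {w : α → ℝ} (hw : Integrable w μ)
    {g : ℝ → ℝ} (hg : ContDiff ℝ (⊤ : ℕ∞) g) :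
    ContDiff ℝ (⊤ : ℕ∞) fun s : ℝ ↦ ∫ a, w a * g (1 + (s - 1) * u a) ∂μ := by
  have bound : ∀ {h : ℝ → ℝ}, Continuous h → ∀ s : ℝ, ∃ C, ∀ x ∈ Metric.ball s 1, ∀ a,
      ‖h (1 + (x - 1) * u a)‖ ≤ C := by
    intro h hh s
    obtain ⟨C, hC⟩ := (isCompact_Icc (a := -(|s| + 3)) (b := |s| + 3)).exists_bound_of_continuousOn
      hh.continuousOn
    refine ⟨C, fun x hx a ↦ hC _ (abs_le.mp ?_)⟩
    have hxs : |x - s| < 1 := by simpa [Real.dist_eq] using hx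
    have hx1 : |x - 1| ≤ |s| + 2 := by
      calc |x - 1| = |(x - s) + s + (-1)| := by ring_nf
        _ ≤ |x - s| + |s| + |(-1 : ℝ)| := abs_add_three _ _ _
        _ ≤ |s| + 2 := by norm_num; linarith
    calc |1 + (x - 1) * u a| ≤ |1| + |(x - 1) * u a| := abs_add_le _ _
      _ ≤ |s| + 3 := by
        rw [abs_mul, abs_one]
        nlinarith [mul_le_mul_of_nonneg_left (hu1 a) (abs_nonneg (x - 1))]
  have meas : ∀ {h : ℝ → ℝ}, Continuous h → ∀ s : ℝ,
      AEStronglyMeasurable (fun a ↦ h (1 + (s - 1) * u a)) μ := fun hh s ↦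
    (hh.measurable.comp (by fun_prop)).aestronglyMeasurable
  have key : ∀ {w : α → ℝ}, Integrable w μ → ∀ {g : ℝ → ℝ}, ContDiff ℝ (⊤ : ℕ∞) g → ∀ s : ℝ,
      HasDerivAt (fun s : ℝ ↦ ∫ a, w a * g (1 + (s - 1) * u a) ∂μ)
        (∫ a, (w a * u a) * deriv g (1 + (s - 1) * u a) ∂μ) s := by
    intro w hw g hg s
    have hdg : Continuous (deriv g) := hg.continuous_deriv (by simp)
    obtain ⟨C, hC⟩ := bound hg.continuous s
    obtain ⟨D, hD⟩ := bound hdg s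
    refine (hasDerivAt_integral_of_dominated_loc_of_deriv_le (bound := fun a ↦ ‖w a‖ * D)
      (F := fun x a ↦ w a * g (1 + (x - 1) * u a))
      (F' := fun x a ↦ (w a * u a) * deriv g (1 + (x - 1) * u a))
      (Metric.ball_mem_nhds s one_pos) (.of_forall fun x ↦ ?_) ?_ ?_ ?_ ?_ ?_).2
    · exact hw.aestronglyMeasurable.mul (meas hg.continuous x)
    · exact hw.mul_bdd (c := C) (meas hg.continuous s)
        (.of_forall (hC s (Metric.mem_ball_self one_pos)))
    · exact (hw.aestronglyMeasurable.mul hu.aestronglyMeasurable).mul (meas hdg s)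
    · refine .of_forall fun a x hx ↦ ?_
      rw [norm_mul, norm_mul]
      have := hD x hx a
      have h1 : ‖w a‖ * ‖u a‖ ≤ ‖w a‖ := mul_le_of_le_one_right (norm_nonneg _) (hu1 a)
      gcongr
    · exact hw.norm.mul_const D
    · refine .of_forall fun a x _ ↦ ?_
      have h1 : HasDerivAt (fun x : ℝ ↦ 1 + (x - 1) * u a) (u a) x := by
        simpa using (((hasDerivAt_id x).sub_const 1).mul_const (u a)).const_add 1
      have h2 := (hg.differentiable (by simp) (1 + (x - 1) * u a)).hasDerivAt
      exact ((h2.comp x h1).const_mul (w a)).congr_deriv (by ring)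
  refine contDiff_infty.mpr fun n ↦ ?_
  induction n generalizing w g with
  | zero =>
    exact contDiff_zero.mpr (continuous_iff_continuousAt.mpr fun s ↦ (key hw hg s).continuousAt)
  | succ n ih =>
    push_cast
    refine contDiff_succ_iff_deriv.mpr ⟨fun s ↦ (key hw hg s).differentiableAt, by simp, ?_⟩
    rw [funext fun s ↦ (key hw hg s).deriv]
    refine ih (hw.mul_bdd (c := 1) hu.aestronglyMeasurable (.of_forall hu1)) ?_
    exact (contDiff_infty_iff_deriv.mp hg).2

/-- Dividing a smooth function that vanishes near the origin by the variable keeps it smooth. -/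
theorem ContDiff.inv_mul_of_eq_zero {θ : ℝ → ℝ} {n : WithTop ℕ∞} (hθ : ContDiff ℝ n θ)
    (h0 : ∀ᶠ t in nhds 0, θ t = 0) : ContDiff ℝ n fun t ↦ t⁻¹ * θ t := by
  refine contDiff_iff_contDiffAt.mpr fun t ↦ ?_
  obtain rfl | ht := eq_or_ne t 0
  · refine (contDiffAt_const (c := (0 : ℝ))).congr_of_eventuallyEq ?_
    filter_upwards [h0] with t ht
    simp [ht]
  · exact (contDiffAt_inv ℝ ht).mul hθ.contDiffAt

/-- The function `F` is infinitely differentiable on the closed half-line `(-∞, 1/10]`. -/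
theorem F_contDiffOn_Iic
    (θ F : ℝ → ℝ)
    (hθ : ContDiff ℝ (⊤ : ℕ∞) θ)
    (hθ01 : ∀ σ, θ σ ∈ Set.Icc (0 : ℝ) 1)
    (hθ0 : ∀ σ ≤ (1 : ℝ) / 10, θ σ = 0)
    (hθ1 : ∀ σ ≥ (1 : ℝ) / 5, θ σ = 1)
    (hF : ∀ σ' : ℝ, F σ' = ∫ σ : ℝ, (σ ^ 2 + σ')⁻¹ * θ ((σ ^ 2 + σ') / (σ ^ 2 + 1))) :
    ContDiffOn ℝ (⊤ : ℕ∞) F (Set.Iic ((1 : ℝ) / 10)) := by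
  have hg := hθ.inv_mul_of_eq_zero <|
    (eventually_le_nhds (show (0 : ℝ) < 1 / 10 by norm_num)).mono hθ0
  have hu1 : ∀ σ : ℝ, |(1 + σ ^ 2)⁻¹| ≤ 1 := fun σ ↦ by
    rw [abs_of_pos (by positivity)]
    exact inv_le_one_of_one_le₀ (by nlinarith [sq_nonneg σ])
  have hsmooth := contDiff_integral_mul_comp_affine_s6 (by fun_prop) hu1 integrable_inv_one_add_sq hg
  convert hsmooth.contDiffOn using 1
  ext s
  rw [hF]
  refine integral_congr_ae (.of_forall fun σ ↦ ?_)
  have hpos : (1 + σ ^ 2 : ℝ) ≠ 0 := by positivity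
  have harg : 1 + (s - 1) * (1 + σ ^ 2)⁻¹ = (σ ^ 2 + s) / (σ ^ 2 + 1) := by
    rw [add_comm (σ ^ 2) 1]
    field_simp
    ring
  simp only [harg]
  rw [← mul_assoc, ← mul_inv, add_comm (1 : ℝ), mul_div_cancel₀ _ (by rwa [add_comm])]
end
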